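/- arXiv:2605.13126 — 5 statements merged into one kernel-verified Lean document; each statement's English description precedes it below -/
import Mathlib

section
/- Let μ and ν be probability measures on a measurable space with μ absolutely continuous with respect to ν, and let g be a measurable real-valued function such that g is μ-integrable and the function exp(g − 1) is ν-integrable. Then ∫ g dμ − ∫ exp(g − 1) dν ≤ KL(μ ‖ ν). -/
open MeasureTheory

/-- The Kullback–Leibler divergence `KL(μ ‖ ν)`: equal to `∫ log (dμ/dν) dμ` when
`μ ≪ ν` and the log-density is `μ`-integrable, and `+∞` otherwise. -/
noncomputable def klDivergence {α : Type*} [MeasurableSpace α] (μ ν : Measure α) : EReal :=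
  open Classical in
  if μ ≪ ν ∧ Integrable (fun x => Real.log ((μ.rnDeriv ν x).toReal)) μ then
    ((∫ x, Real.log ((μ.rnDeriv ν x).toReal) ∂μ : ℝ) : EReal)
  else ⊤

/-- The Fenchel–Young inequality for `r ↦ r * log r`, whose convex conjugate is
`y ↦ exp (y - 1)`. -/
lemma mul_sub_exp_sub_one_le_mul_log {r : ℝ} (hr : 0 ≤ r) (y : ℝ) :
    r * y - Real.exp (y - 1) ≤ r * Real.log r := by
  rcases hr.eq_or_lt with rfl | hr
  · simpa using (Real.exp_pos (y - 1)).le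
  · have hexp : r * Real.exp (y - 1 - Real.log r) = Real.exp (y - 1) := by
      rw [Real.exp_sub, Real.exp_log hr, mul_div_cancel₀ _ hr.ne']
    have htangent :=
      mul_le_mul_of_nonneg_left (Real.add_one_le_exp (y - 1 - Real.log r)) hr.le
    rw [hexp] at htangent
    linarith

/-- Nguyen–Wainwright–Jordan variational lower bound on the KL divergence:
for probability measures `μ ≪ ν` and a measurable `g` with `g` `μ`-integrable and
`exp (g - 1)` `ν`-integrable, `∫ g dμ - ∫ exp (g - 1) dν ≤ KL(μ ‖ ν)`. -/
theorem nwj_lower_bound {α : Type*} [MeasurableSpace α] (μ ν : Measure α)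
    [IsProbabilityMeasure μ] [IsProbabilityMeasure ν] (hμν : μ ≪ ν)
    (g : α → ℝ) (hg : Measurable g)
    (hg_int : Integrable g μ)
    (hexp_int : Integrable (fun x => Real.exp (g x - 1)) ν) :
    ((∫ x, g x ∂μ - ∫ x, Real.exp (g x - 1) ∂ν : ℝ) : EReal) ≤ klDivergence μ ν := by
  unfold klDivergence
  split_ifs with h
  · rw [EReal.coe_le_coe_iff, ← integral_toReal_rnDeriv_mul hμν (f := g),
      ← integral_toReal_rnDeriv_mul hμν
        (f := fun x => Real.log ((μ.rnDeriv ν x).toReal))]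
    have hmul_int := (integrable_toReal_rnDeriv_mul_iff hμν).mpr hg_int
    rw [← integral_sub hmul_int hexp_int]
    exact integral_mono (hmul_int.sub hexp_int)
      ((integrable_toReal_rnDeriv_mul_iff hμν).mpr h.2)
      fun x => mul_sub_exp_sub_one_le_mul_log ENNReal.toReal_nonneg (g x)
  · exact le_top
end

section
/- Let μ be a probability measure on a product of measurable spaces S × T, with first marginal μ₁ on S and second marginal μ₂ on T. Let q₁ : T × S → ℝ and q₂ : S → ℝ be measurable and strictly positive (interpreted as a variational conditional density Q₁(y | z) and a variational marginal density Q₂(y)). Assume that (y, z) ↦ log(q₁(z, y)/q₂(y)) is μ-integrable and that (y, z) ↦ q₁(z, y)/q₂(y) is integrable with respect to the product measure μ₁ ⊗ μ₂. Then KL(μ ‖ μ₁ ⊗ μ₂) ≥ 1 + ∫_{S×T} log(q₁(z, y)/q₂(y)) dμ(y, z) − ∫_{S×T} (q₁(z, y)/q₂(y)) d(μ₁ ⊗ μ₂)(y, z). -/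
open MeasureTheory

/-- The unnormalized Donsker–Varadhan (Nguyen–Wainwright–Jordan) lower bound on the
Kullback–Leibler divergence. -/
theorem one_add_integral_log_sub_integral_le_klDivergence {α : Type*} [MeasurableSpace α]
    (μ ν : Measure α) [IsProbabilityMeasure μ] [SigmaFinite ν] {g : α → ℝ}
    (hg_pos : ∀ x, 0 < g x) (hlog : Integrable (fun x => Real.log (g x)) μ)
    (hg : Integrable g ν) :
    ((1 + ∫ x, Real.log (g x) ∂μ - ∫ x, g x ∂ν : ℝ) : EReal) ≤ klDivergence μ ν := by
  unfold klDivergence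
  split_ifs with h
  · obtain ⟨hμν, hllr⟩ := h
    have hlog' : Integrable (fun x => 1 + Real.log (g x)) μ := (integrable_const 1).add hlog
    have hint := hlog'.sub hllr
    have hle : ∫ x, (1 + Real.log (g x) - Real.log (μ.rnDeriv ν x).toReal) ∂μ
        ≤ ∫ x, g x ∂ν := by
      rw [← integral_rnDeriv_smul hμν]
      refine integral_mono ((integrable_rnDeriv_smul_iff hμν).2 hint) hg fun x => ?_
      simp only [smul_eq_mul]
      rcases (ENNReal.toReal_nonneg (a := μ.rnDeriv ν x)).eq_or_lt with hr | hr
      · simpa [← hr] using (hg_pos x).le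
      · have hineq := Real.log_le_sub_one_of_pos (div_pos (hg_pos x) hr)
        rw [Real.log_div (hg_pos x).ne' hr.ne'] at hineq
        calc _ ≤ (μ.rnDeriv ν x).toReal * (g x / (μ.rnDeriv ν x).toReal) := by
              gcongr
              linarith
          _ = g x := mul_div_cancel₀ _ hr.ne'
    have hsplit : ∫ x, (1 + Real.log (g x) - Real.log (μ.rnDeriv ν x).toReal) ∂μ
        = 1 + ∫ x, Real.log (g x) ∂μ - ∫ x, Real.log (μ.rnDeriv ν x).toReal ∂μ := by
      rw [integral_sub hlog' hllr, integral_add (integrable_const _) hlog]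
      simp
    rw [EReal.coe_le_coe_iff]
    linarith
  · exact le_top

/-- Proposition 1 of the paper, measure-theoretic form: for a joint probability
measure `μ` on `S × T` (points written `(y, z)`) with marginals `μ₁`, `μ₂`, and
strictly positive measurable variational densities `q₁ : T × S → ℝ` (the conditional
`Q₁(y ∣ z)`) and `q₂ : S → ℝ` (the marginal `Q₂(y)`), under the stated integrability,
`KL(μ ‖ μ₁ ⊗ μ₂) ≥ 1 + ∫ log (q₁(z,y)/q₂(y)) dμ − ∫ q₁(z,y)/q₂(y) d(μ₁ ⊗ μ₂)`. -/
theorem mlgib_proposition_one {S T : Type*} [MeasurableSpace S] [MeasurableSpace T]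
    (μ : Measure (S × T)) [IsProbabilityMeasure μ]
    (μ₁ : Measure S) (μ₂ : Measure T)
    (hμ₁ : μ₁ = μ.map Prod.fst) (hμ₂ : μ₂ = μ.map Prod.snd)
    (q₁ : T × S → ℝ) (q₂ : S → ℝ)
    (hq₁_meas : Measurable q₁) (hq₂_meas : Measurable q₂)
    (hq₁_pos : ∀ p, 0 < q₁ p) (hq₂_pos : ∀ y, 0 < q₂ y)
    (h_int₁ : Integrable (fun p : S × T => Real.log (q₁ (p.2, p.1) / q₂ p.1)) μ)
    (h_int₂ : Integrable (fun p : S × T => q₁ (p.2, p.1) / q₂ p.1) (μ₁.prod μ₂)) :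
    ((1 + ∫ p, Real.log (q₁ (p.2, p.1) / q₂ p.1) ∂μ
        - ∫ p, q₁ (p.2, p.1) / q₂ p.1 ∂(μ₁.prod μ₂) : ℝ) : EReal)
      ≤ klDivergence μ (μ₁.prod μ₂) := by
  have : IsProbabilityMeasure μ₁ :=
    hμ₁ ▸ Measure.isProbabilityMeasure_map measurable_fst.aemeasurable
  have : IsProbabilityMeasure μ₂ :=
    hμ₂ ▸ Measure.isProbabilityMeasure_map measurable_snd.aemeasurable
  exact one_add_integral_log_sub_integral_le_klDivergence μ (μ₁.prod μ₂)
    (fun p => div_pos (hq₁_pos _) (hq₂_pos _)) h_int₁ h_int₂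
end

section
/- Let Y and Z be random variables with finite range on a probability space (Ω, 𝓕, μ). Let q₁ be a strictly positive real-valued function on range(Z) × range(Y) and q₂ a strictly positive real-valued function on range(Y). Then I[Y : Z ; μ] ≥ 1 + E_μ[ log(q₁(Z, Y)/q₂(Y)) ] − Σ_{y, z} P(Y = y)·P(Z = z)·(q₁(z, y)/q₂(y)), where the sum ranges over the (finitely many) values y of Y and z of Z. -/
open MeasureTheory

/-- Shannon entropy `H[X ; μ]` of a random variable `X` with finite range,
`H[X] = ∑ s, -P(X = s) log P(X = s)`. -/
noncomputable def finEntropy {Ω S : Type*} [MeasurableSpace Ω] [Fintype S]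
    (μ : Measure Ω) (X : Ω → S) : ℝ :=
  ∑ s : S, Real.negMulLog ((μ (X ⁻¹' {s})).toReal)

/-- Mutual information `I[X : Y ; μ] = H[X] + H[Y] - H[(X, Y)]` for random variables
with finite range. -/
noncomputable def finMutualInfo {Ω S T : Type*} [MeasurableSpace Ω] [Fintype S] [Fintype T]
    (μ : Measure Ω) (X : Ω → S) (Y : Ω → T) : ℝ :=
  finEntropy μ X + finEntropy μ Y - finEntropy μ (fun ω => (X ω, Y ω))

/-- Conditional mutual information
`I[X : Y | Z ; μ] = H[(X, Z)] + H[(Y, Z)] - H[(X, Y, Z)] - H[Z]` for random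
variables with finite range. -/
noncomputable def finCondMutualInfo {Ω S T U : Type*} [MeasurableSpace Ω]
    [Fintype S] [Fintype T] [Fintype U]
    (μ : Measure Ω) (X : Ω → S) (Y : Ω → T) (Z : Ω → U) : ℝ :=
  finEntropy μ (fun ω => (X ω, Z ω)) + finEntropy μ (fun ω => (Y ω, Z ω))
    - finEntropy μ (fun ω => (X ω, Y ω, Z ω)) - finEntropy μ Z

open Real in
/-- The inequality `log t ≤ t - 1` at `t = a * b * r / p`, multiplied by `p`. -/
lemma mul_log_add_sub_le {p a b r : ℝ} (hp : 0 ≤ p) (hpa : p ≤ a) (hpb : p ≤ b) (hr : 0 < r) :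
    p + p * log r - a * b * r ≤ p * log p - p * log a - p * log b := by
  have ha : 0 ≤ a := hp.trans hpa
  have hb : 0 ≤ b := hp.trans hpb
  rcases hp.eq_or_lt with rfl | hp
  · simp only [zero_mul, zero_add, zero_sub, sub_zero, neg_nonpos]
    positivity
  have ha : 0 < a := hp.trans_le hpa
  have hb : 0 < b := hp.trans_le hpb
  have h := mul_le_mul_of_nonneg_left (log_le_sub_one_of_pos (x := a * b * r / p) (by positivity))
    hp.le
  rw [log_div (by positivity) hp.ne', log_mul (by positivity) hr.ne', log_mul ha.ne' hb.ne',
    mul_sub p (_ / p), mul_div_cancel₀ _ hp.ne'] at h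
  linarith

/-- The probability of `X = s` is the sum over `t` of the joint probabilities of
`(X, Y) = (s, t)`. -/
lemma measureReal_preimage_eq_sum_prodMk {Ω S T : Type*} [MeasurableSpace Ω] [Fintype T]
    [MeasurableSpace T] [MeasurableSingletonClass T] (μ : Measure Ω) [IsFiniteMeasure μ]
    (X : Ω → S) {Y : Ω → T} (hY : Measurable Y) (s : S) :
    μ.real (X ⁻¹' {s}) = ∑ t, μ.real ((fun ω => (X ω, Y ω)) ⁻¹' {(s, t)}) := by
  have h := sum_measureReal_preimage_singleton (μ := μ.restrict (X ⁻¹' {s})) (f := Y) Finset.univ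
    fun t _ => hY (measurableSet_singleton t)
  simp only [Finset.coe_univ, Set.preimage_univ, measureReal_restrict_apply_univ,
    measureReal_restrict_apply (hY (measurableSet_singleton _))] at h
  rw [← h]
  refine Finset.sum_congr rfl fun t _ => congrArg μ.real ?_
  ext ω
  simp [and_comm]

/-- The expectation of a function of a random variable with finite range. -/
lemma integral_comp_eq_sum {Ω S : Type*} [MeasurableSpace Ω] [Fintype S]
    [MeasurableSpace S] [MeasurableSingletonClass S] (μ : Measure Ω) [IsFiniteMeasure μ]
    {X : Ω → S} (hX : Measurable X) (f : S → ℝ) :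
    ∫ ω, f (X ω) ∂μ = ∑ s, μ.real (X ⁻¹' {s}) * f s := by
  rw [← integral_map hX.aemeasurable (measurable_of_finite f).aestronglyMeasurable,
    integral_fintype .of_finite]
  simp [map_measureReal_apply hX (measurableSet_singleton _)]

open Real in
/-- Mutual information as a sum over the joint range. -/
lemma finMutualInfo_eq_sum {Ω S T : Type*} [MeasurableSpace Ω]
    [Fintype S] [MeasurableSpace S] [MeasurableSingletonClass S]
    [Fintype T] [MeasurableSpace T] [MeasurableSingletonClass T]
    (μ : Measure Ω) [IsFiniteMeasure μ] {X : Ω → S} {Y : Ω → T}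
    (hX : Measurable X) (hY : Measurable Y) :
    finMutualInfo μ X Y = ∑ s, ∑ t,
      (μ.real ((fun ω => (X ω, Y ω)) ⁻¹' {(s, t)}) *
          log (μ.real ((fun ω => (X ω, Y ω)) ⁻¹' {(s, t)}))
        - μ.real ((fun ω => (X ω, Y ω)) ⁻¹' {(s, t)}) * log (μ.real (X ⁻¹' {s}))
        - μ.real ((fun ω => (X ω, Y ω)) ⁻¹' {(s, t)}) * log (μ.real (Y ⁻¹' {t}))) := by
  have hswap (t : T) : μ.real (Y ⁻¹' {t}) =
      ∑ s, μ.real ((fun ω => (X ω, Y ω)) ⁻¹' {(s, t)}) := by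
    rw [measureReal_preimage_eq_sum_prodMk μ Y hX t]
    refine Finset.sum_congr rfl fun s _ => congrArg μ.real ?_
    ext ω
    simp [and_comm]
  have hHX : finEntropy μ X = -∑ s, ∑ t,
      μ.real ((fun ω => (X ω, Y ω)) ⁻¹' {(s, t)}) * log (μ.real (X ⁻¹' {s})) := by
    simp only [← Finset.sum_mul, ← measureReal_preimage_eq_sum_prodMk μ X hY]
    simp [finEntropy, negMulLog, measureReal_def]
  have hHY : finEntropy μ Y = -∑ s, ∑ t,
      μ.real ((fun ω => (X ω, Y ω)) ⁻¹' {(s, t)}) * log (μ.real (Y ⁻¹' {t})) := by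
    rw [Finset.sum_comm]
    simp only [← Finset.sum_mul, ← hswap]
    simp [finEntropy, negMulLog, measureReal_def]
  have hHXY : finEntropy μ (fun ω => (X ω, Y ω)) = -∑ s, ∑ t,
      μ.real ((fun ω => (X ω, Y ω)) ⁻¹' {(s, t)}) *
        log (μ.real ((fun ω => (X ω, Y ω)) ⁻¹' {(s, t)})) := by
    simp [finEntropy, negMulLog, measureReal_def, Fintype.sum_prod_type]
  rw [finMutualInfo, hHX, hHY, hHXY]
  simp only [Finset.sum_sub_distrib]
  ring

/-- Proposition 1 of the paper for finite-valued random variables: for random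
variables `Y`, `Z` with finite range on a probability space and strictly positive
variational functions `q₁` on `range(Z) × range(Y)` and `q₂` on `range(Y)`,
`I[Y : Z ; μ] ≥ 1 + E_μ[log (q₁(Z,Y)/q₂(Y))] − ∑_{y,z} P(Y=y) P(Z=z) q₁(z,y)/q₂(y)`. -/
theorem mlgib_proposition_one_finite {Ω S T : Type*} [MeasurableSpace Ω]
    [Fintype S] [MeasurableSpace S] [MeasurableSingletonClass S]
    [Fintype T] [MeasurableSpace T] [MeasurableSingletonClass T]
    (μ : Measure Ω) [IsProbabilityMeasure μ]
    (Y : Ω → S) (Z : Ω → T) (hY : Measurable Y) (hZ : Measurable Z)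
    (q₁ : T × S → ℝ) (q₂ : S → ℝ)
    (hq₁_pos : ∀ p, 0 < q₁ p) (hq₂_pos : ∀ y, 0 < q₂ y) :
    finMutualInfo μ Y Z ≥
      1 + (∫ ω, Real.log (q₁ (Z ω, Y ω) / q₂ (Y ω)) ∂μ)
        - ∑ y : S, ∑ z : T,
            (μ (Y ⁻¹' {y})).toReal * (μ (Z ⁻¹' {z})).toReal * (q₁ (z, y) / q₂ y) := by
  have hYZ : Measurable fun ω => (Y ω, Z ω) := hY.prodMk hZ
  have hone : ∑ y, ∑ z, μ.real ((fun ω => (Y ω, Z ω)) ⁻¹' {(y, z)}) = 1 := by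
    simpa [Fintype.sum_prod_type] using (integral_comp_eq_sum μ hYZ fun _ => 1).symm
  have hint := integral_comp_eq_sum μ hYZ fun x => Real.log (q₁ (x.2, x.1) / q₂ x.1)
  rw [Fintype.sum_prod_type] at hint
  rw [ge_iff_le, finMutualInfo_eq_sum μ hY hZ, hint, ← hone]
  simp only [← Finset.sum_add_distrib, ← Finset.sum_sub_distrib, ← measureReal_def]
  refine Finset.sum_le_sum fun y _ => Finset.sum_le_sum fun z _ => ?_
  have hle : μ.real ((fun ω => (Y ω, Z ω)) ⁻¹' {(y, z)}) ≤ μ.real (Y ⁻¹' {y}) :=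
    measureReal_mono fun ω hω => congrArg Prod.fst hω
  have hle' : μ.real ((fun ω => (Y ω, Z ω)) ⁻¹' {(y, z)}) ≤ μ.real (Z ⁻¹' {z}) :=
    measureReal_mono fun ω hω => congrArg Prod.snd hω
  exact mul_log_add_sub_le measureReal_nonneg hle hle' (div_pos (hq₁_pos _) (hq₂_pos _))
end

section
/- Let μ_X be a probability measure on a measurable space S, let κ be a Markov kernel from S to a measurable space T, let μ = μ_X ⊗ κ be the induced joint probability measure on S × T, and let μ_Y be the second marginal of μ. Let q be a probability measure on T such that μ_Y is absolutely continuous with respect to q and, for μ_X-almost every x, κ(x) is absolutely continuous with respect to q with jointly measurable density f(x, ·) = d(κ x)/dq. Assume KL(μ ‖ μ_X ⊗ μ_Y) < ∞, KL(μ_Y ‖ q) < ∞, and that (x, y) ↦ log f(x, y) is μ-integrable. Then ∫_{S×T} log f(x, y) dμ(x, y) = KL(μ ‖ μ_X ⊗ μ_Y) + KL(μ_Y ‖ q). In particular, KL(μ ‖ μ_X ⊗ μ_Y) ≤ ∫ log f dμ. -/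
open MeasureTheory ProbabilityTheory ENNReal

open Measure in
/-- If `κ x` has density `f (x, ·)` with respect to `q` for almost every `x`, then `μ ⊗ κ` has
density `f` with respect to `μ × q`. -/
lemma compProd_eq_prod_withDensity {S T : Type*} [MeasurableSpace S] [MeasurableSpace T]
    {μ : Measure S} [SFinite μ] {κ : Kernel S T} [IsSFiniteKernel κ] {q : Measure T} [SFinite q]
    {f : S × T → ℝ≥0∞} (hf : Measurable f)
    (hκ : ∀ᵐ x ∂μ, κ x = q.withDensity (fun y => f (x, y))) :
    μ.compProd κ = (μ.prod q).withDensity f := by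
  ext s hs
  rw [compProd_apply hs, withDensity_apply _ hs, ← lintegral_indicator hs,
    lintegral_prod _ (hf.indicator hs).aemeasurable]
  refine lintegral_congr_ae ?_
  filter_upwards [hκ] with x hx
  have hsx : MeasurableSet (Prod.mk x ⁻¹' s) := measurable_prodMk_left hs
  rw [hx, withDensity_apply _ hsx, ← lintegral_indicator hsx]
  rfl

lemma klDivergence_lt_top_iff {α : Type*} [MeasurableSpace α] {μ ν : Measure α} :
    klDivergence μ ν < ⊤ ↔ μ ≪ ν ∧ Integrable (llr μ ν) μ := by
  unfold klDivergence
  split_ifs with h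
  · exact ⟨fun _ => h, fun _ => EReal.coe_lt_top _⟩
  · exact ⟨fun hlt => absurd hlt (lt_irrefl _), fun h' => absurd h' h⟩

lemma klDivergence_of_ac_of_integrable {α : Type*} [MeasurableSpace α] {μ ν : Measure α}
    (hac : μ ≪ ν) (hint : Integrable (llr μ ν) μ) :
    klDivergence μ ν = ((∫ x, llr μ ν x ∂μ : ℝ) : EReal) :=
  if_pos ⟨hac, hint⟩

lemma integral_llr_nonneg {α : Type*} [MeasurableSpace α] {μ ν : Measure α}
    [IsProbabilityMeasure μ] [IsProbabilityMeasure ν]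
    (hac : μ ≪ ν) (hint : Integrable (llr μ ν) μ) : 0 ≤ ∫ x, llr μ ν x ∂μ := by
  simpa using InformationTheory.integral_llr_add_sub_measure_univ_nonneg hac hint

open Measure in
/-- If `ν` is the second marginal of `μ`, the log-density of `μ` with respect to `μX × q` splits as
`log (dμ/d(μX × ν)) + log (dν/dq)`. -/
lemma log_density_prod_eq_llr_add_llr {S T : Type*} [MeasurableSpace S] [MeasurableSpace T]
    {μX : Measure S} {ν q : Measure T} {μ : Measure (S × T)} [IsProbabilityMeasure μX]
    [IsProbabilityMeasure ν] [IsProbabilityMeasure q] [IsProbabilityMeasure μ]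
    (hsnd : μ.snd = ν) (hν : ν ≪ q) (hac : μ ≪ μX.prod ν) {f : S × T → ℝ≥0∞} (hf : Measurable f)
    (hμ : μ = (μX.prod q).withDensity f) :
    (fun p => Real.log (f p).toReal) =ᵐ[μ] fun p => llr μ (μX.prod ν) p + llr ν q p.2 := by
  have hr : Measurable fun p : S × T => ν.rnDeriv q p.2 :=
    (measurable_rnDeriv ν q).comp measurable_snd
  have hprod : μX.prod ν = (μX.prod q).withDensity fun p => ν.rnDeriv q p.2 := by
    conv_lhs => rw [← withDensity_rnDeriv_eq ν q hν]
    exact prod_withDensity_right (measurable_rnDeriv ν q)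
  have hdens : (μX.prod q).withDensity f = (μX.prod q).withDensity
      ((fun p => ν.rnDeriv q p.2) * μ.rnDeriv (μX.prod ν)) := by
    rw [withDensity_mul _ hr (measurable_rnDeriv _ _), ← hprod, withDensity_rnDeriv_eq _ _ hac,
      ← hμ]
  have hμq : μ ≪ μX.prod q := hμ ▸ withDensity_absolutelyContinuous _ _
  have hfin : ∫⁻ p, f p ∂(μX.prod q) ≠ ∞ := by
    rw [← setLIntegral_univ, ← withDensity_apply _ .univ, ← hμ]
    exact measure_ne_top _ _
  have heq := (withDensity_eq_iff hf.aemeasurable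
    (hr.mul (measurable_rnDeriv _ _)).aemeasurable hfin).1 hdens
  have hquasi : QuasiMeasurePreserving Prod.snd μ ν :=
    ⟨measurable_snd, by rw [← hsnd]; exact AbsolutelyContinuous.rfl⟩
  filter_upwards [hμq.ae_le heq, rnDeriv_pos hac, hac.ae_le (rnDeriv_lt_top μ (μX.prod ν)),
    hquasi.ae (rnDeriv_pos hν), hquasi.ae (hν.ae_le (rnDeriv_lt_top ν q))] with p hp h1 h2 h3 h4
  rw [hp, Pi.mul_apply, ENNReal.toReal_mul, mul_comm,
    Real.log_mul (ENNReal.toReal_pos h1.ne' h2.ne).ne' (ENNReal.toReal_pos h3.ne' h4.ne).ne']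
  rfl

/-- Measure-theoretic form of the variational upper bound in the paper's proof of
Proposition 2: with `μ = μ_X ⊗ κ`, `μ_Y` the second marginal of `μ`, and
`f(x, ·) = d(κ x)/dq` for a variational reference probability measure `q`,
`∫ log f dμ = KL(μ ‖ μ_X ⊗ μ_Y) + KL(μ_Y ‖ q)`; in particular
`KL(μ ‖ μ_X ⊗ μ_Y) ≤ ∫ log f dμ`. -/
theorem klDiv_variational_upper_bound {S T : Type*}
    [MeasurableSpace S] [MeasurableSpace T]
    (μX : Measure S) [IsProbabilityMeasure μX]
    (κ : Kernel S T) [IsMarkovKernel κ]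
    (μ : Measure (S × T)) (hμ : μ = μX.compProd κ)
    (μY : Measure T) (hμY : μY = μ.snd)
    (q : Measure T) [IsProbabilityMeasure q]
    (habs : μY ≪ q)
    (f : S × T → ℝ≥0∞) (hf_meas : Measurable f)
    (hf_density : ∀ᵐ x ∂μX, κ x = q.withDensity (fun y => f (x, y)))
    (hKL₁ : klDivergence μ (μX.prod μY) < ⊤)
    (hKL₂ : klDivergence μY q < ⊤)
    (hlog_int : Integrable (fun p => Real.log ((f p).toReal)) μ) :
    ((∫ p, Real.log ((f p).toReal) ∂μ : ℝ) : EReal)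
        = klDivergence μ (μX.prod μY) + klDivergence μY q ∧
      klDivergence μ (μX.prod μY) ≤ ((∫ p, Real.log ((f p).toReal) ∂μ : ℝ) : EReal) := by
  obtain ⟨hac₁, hint₁⟩ := klDivergence_lt_top_iff.1 hKL₁
  obtain ⟨-, hint₂⟩ := klDivergence_lt_top_iff.1 hKL₂
  have : IsProbabilityMeasure μ := by rw [hμ]; infer_instance
  have : IsProbabilityMeasure μY := by rw [hμY]; infer_instance
  have hlog := log_density_prod_eq_llr_add_llr hμY.symm habs hac₁ hf_meas
    (hμ.trans (compProd_eq_prod_withDensity hf_meas hf_density))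
  have hmap : μ.map Prod.snd = μY := hμY.symm
  have hint_snd : Integrable (fun p : S × T => llr μY q p.2) μ :=
    (hmap ▸ hint₂ : Integrable (llr μY q) (μ.map Prod.snd)).comp_measurable measurable_snd
  have hsnd : ∫ p, llr μY q p.2 ∂μ = ∫ y, llr μY q y ∂μY := by
    rw [← integral_map (μ := μ) measurable_snd.aemeasurable
      (measurable_llr μY q).aestronglyMeasurable, hmap]
  have hsum : ∫ p, Real.log (f p).toReal ∂μ
      = ∫ p, llr μ (μX.prod μY) p ∂μ + ∫ y, llr μY q y ∂μY := by
    rw [integral_congr_ae hlog, integral_add hint₁ hint_snd, hsnd]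
  rw [klDivergence_of_ac_of_integrable hac₁ hint₁, klDivergence_of_ac_of_integrable habs hint₂,
    hsum]
  exact ⟨EReal.coe_add _ _,
    EReal.coe_le_coe_iff.2 (le_add_of_nonneg_right (integral_llr_nonneg habs hint₂))⟩
end

section
/- Let D, W, V, H be random variables with finite range on a probability space (Ω, 𝓕, μ). Assume W is conditionally independent of the pair (D, H) given V, in the sense that I[W : (D, H) | V ; μ] = 0. Then I[D : W | H ; μ] ≤ I[W : V ; μ]. -/
open MeasureTheory

/-- Shannon entropy is invariant under relabelling the values of the random variable. -/
lemma finEntropy_equiv_comp {Ω S T : Type*} [MeasurableSpace Ω] [Fintype S] [Fintype T]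
    (μ : Measure Ω) (X : Ω → S) (e : S ≃ T) :
    finEntropy μ (fun ω => e (X ω)) = finEntropy μ X := by
  unfold finEntropy
  rw [← e.sum_comp]
  refine Finset.sum_congr rfl fun s _ => ?_
  congr 3
  ext ω
  simp

lemma sum_measureReal_fiber {Ω S T : Type*} [MeasurableSpace Ω]
    [Fintype S] [MeasurableSpace S] [MeasurableSingletonClass S] [DecidableEq T]
    (μ : Measure Ω) [IsFiniteMeasure μ] {X : Ω → S} (hX : Measurable X) (f : S → T) (t : T) :
    ∑ s with f s = t, μ.real (X ⁻¹' {s}) = μ.real ((fun ω => f (X ω)) ⁻¹' {t}) := by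
  rw [sum_measureReal_preimage_singleton _ fun s _ => hX (measurableSet_singleton s)]
  congr 1
  ext ω
  simp

/-- The entropy of a function of `X`, as a sum over the values of `X`. -/
lemma finEntropy_comp {Ω S T : Type*} [MeasurableSpace Ω]
    [Fintype S] [MeasurableSpace S] [MeasurableSingletonClass S] [Fintype T]
    (μ : Measure Ω) [IsFiniteMeasure μ] {X : Ω → S} (hX : Measurable X) (f : S → T) :
    finEntropy μ (fun ω => f (X ω)) =
      -∑ s, μ.real (X ⁻¹' {s}) * Real.log (μ.real ((fun ω => f (X ω)) ⁻¹' {f s})) := by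
  classical
  rw [← Finset.sum_fiberwise Finset.univ f, ← Finset.sum_neg_distrib]
  refine Finset.sum_congr rfl fun t _ => ?_
  rw [Real.negMulLog, ← measureReal_def, neg_mul, neg_inj]
  nth_rewrite 1 [← sum_measureReal_fiber μ hX f t]
  rw [Finset.sum_mul]
  refine Finset.sum_congr rfl fun s hs => ?_
  rw [(Finset.mem_filter.1 hs).2]

lemma sum_measureReal_pair {Ω S T : Type*} [MeasurableSpace Ω]
    [Fintype S] [MeasurableSpace S] [MeasurableSingletonClass S]
    [MeasurableSpace T] [MeasurableSingletonClass T]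
    (μ : Measure Ω) [IsFiniteMeasure μ] {X : Ω → S} {Y : Ω → T}
    (hX : Measurable X) (hY : Measurable Y) (t : T) :
    ∑ s, μ.real ((fun ω => (X ω, Y ω)) ⁻¹' {(s, t)}) = μ.real (Y ⁻¹' {t}) := by
  rw [← measureReal_biUnion_finset]
  · congr 1
    ext ω
    simp
  · intro s _ s' _ hne
    refine Set.disjoint_left.2 fun ω h h' => hne ?_
    simp only [Set.mem_preimage, Set.mem_singleton_iff, Prod.mk.injEq] at h h'
    exact h.1.symm.trans h'.1
  · exact fun s _ => (hX.prodMk hY) (measurableSet_singleton _)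

lemma sub_le_mul_log_add_log_sub_log {p a b c : ℝ} (hp : 0 ≤ p) (ha : p ≤ a) (hb : p ≤ b)
    (hc : p ≤ c) :
    p - a * b / c ≤ p * (Real.log p + Real.log c - Real.log a - Real.log b) := by
  rcases hp.eq_or_lt with rfl | hp
  · simpa using div_nonneg (mul_nonneg ha hb) hc
  have ha' := hp.trans_le ha
  have hb' := hp.trans_le hb
  have hc' := hp.trans_le hc
  have h := Real.one_sub_inv_le_log_of_pos (x := p * c / (a * b)) (by positivity)
  rw [Real.log_div (by positivity) (by positivity), Real.log_mul hp.ne' hc'.ne',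
    Real.log_mul ha'.ne' hb'.ne'] at h
  calc p - a * b / c = p * (1 - (p * c / (a * b))⁻¹) := by field_simp
    _ ≤ p * (Real.log p + Real.log c - Real.log a - Real.log b) :=
      mul_le_mul_of_nonneg_left (by linarith) hp.le

/-- Submodularity of Shannon entropy. -/
lemma finCondMutualInfo_nonneg {Ω S T U : Type*} [MeasurableSpace Ω]
    [Fintype S] [MeasurableSpace S] [MeasurableSingletonClass S]
    [Fintype T] [MeasurableSpace T] [MeasurableSingletonClass T]
    [Fintype U] [MeasurableSpace U] [MeasurableSingletonClass U]
    (μ : Measure Ω) [IsFiniteMeasure μ] {X : Ω → S} {Y : Ω → T} {Z : Ω → U}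
    (hX : Measurable X) (hY : Measurable Y) (hZ : Measurable Z) :
    0 ≤ finCondMutualInfo μ X Y Z := by
  set p : S × T × U → ℝ := fun x => μ.real ((fun ω => (X ω, Y ω, Z ω)) ⁻¹' {x})
  set a : S × U → ℝ := fun x => μ.real ((fun ω => (X ω, Z ω)) ⁻¹' {x})
  set b : T × U → ℝ := fun x => μ.real ((fun ω => (Y ω, Z ω)) ⁻¹' {x})
  set c : U → ℝ := fun x => μ.real (Z ⁻¹' {x})
  have hXYZ : Measurable fun ω => (X ω, Y ω, Z ω) := hX.prodMk (hY.prodMk hZ)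
  have hsum : finCondMutualInfo μ X Y Z = ∑ x : S × T × U, p x *
      (Real.log (p x) + Real.log (c x.2.2) - Real.log (a (x.1, x.2.2)) - Real.log (b x.2)) := by
    have h₁ := finEntropy_comp μ hXYZ fun x => (x.1, x.2.2)
    have h₂ := finEntropy_comp μ hXYZ fun x => x.2
    have h₃ := finEntropy_comp μ hXYZ fun x => x.2.2
    have h₄ := finEntropy_comp μ hXYZ fun x => x
    simp only [mul_sub, mul_add, Finset.sum_sub_distrib, Finset.sum_add_distrib]
    unfold finCondMutualInfo
    linarith
  have hac (u : U) : ∑ s, a (s, u) = c u := sum_measureReal_pair μ hX hZ u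
  have hpb (x : T × U) : ∑ s, p (s, x) = b x := sum_measureReal_pair μ hX (hY.prodMk hZ) x
  have hprod : ∑ x : S × T × U, a (x.1, x.2.2) * b x.2 / c x.2.2 = ∑ x, p x := by
    rw [Fintype.sum_prod_type_right, Fintype.sum_prod_type_right p]
    simp only [hpb, ← Finset.sum_div, ← Finset.sum_mul, hac]
    refine Finset.sum_congr rfl fun x _ => ?_
    rw [mul_div_right_comm]
    rcases eq_or_ne (c x.2) 0 with h | h
    · have hbx : b x ≤ c x.2 := by
        refine measureReal_mono fun ω hω => ?_
        simp only [Set.mem_preimage, Set.mem_singleton_iff] at hω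
        simp [← hω]
      rw [show b x = 0 from le_antisymm (h ▸ hbx) measureReal_nonneg, mul_zero]
    · rw [div_self h, one_mul]
  rw [hsum, ← sub_self (∑ x, p x)]
  nth_rewrite 2 [← hprod]
  rw [← Finset.sum_sub_distrib]
  refine Finset.sum_le_sum fun x _ => sub_le_mul_log_add_log_sub_log measureReal_nonneg ?_ ?_ ?_
  all_goals
    refine measureReal_mono fun ω hω => ?_
    simp only [Set.mem_preimage, Set.mem_singleton_iff] at hω
    simp [← hω]

lemma finMutualInfo_nonneg {Ω S T : Type*} [MeasurableSpace Ω]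
    [Fintype S] [MeasurableSpace S] [MeasurableSingletonClass S]
    [Fintype T] [MeasurableSpace T] [MeasurableSingletonClass T]
    (μ : Measure Ω) [IsProbabilityMeasure μ] {X : Ω → S} {Y : Ω → T}
    (hX : Measurable X) (hY : Measurable Y) :
    0 ≤ finMutualInfo μ X Y := by
  have h := finCondMutualInfo_nonneg μ hX hY (measurable_const (a := ()))
  have h₁ := finEntropy_equiv_comp μ X (Equiv.prodPUnit S).symm
  have h₂ := finEntropy_equiv_comp μ Y (Equiv.prodPUnit T).symm
  have h₃ := finEntropy_equiv_comp μ (fun ω => (X ω, Y ω))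
    ((Equiv.refl S).prodCongr (Equiv.prodPUnit T).symm)
  have h₄ : finEntropy μ (fun _ => ()) = 0 := by simp [finEntropy]
  simp only [Equiv.prodPUnit_symm_apply, Equiv.prodCongr_apply, Prod.map_apply,
    Equiv.refl_apply] at h₁ h₂ h₃
  unfold finCondMutualInfo at h
  unfold finMutualInfo
  linarith

/-- The key inequality in the paper's proof of its Proposition 2: if `W` is
conditionally independent of the pair `(D, H)` given `V`
(i.e. `I[W : (D, H) | V ; μ] = 0`), then `I[D : W | H ; μ] ≤ I[W : V ; μ]`. -/
theorem condMutualInfo_le_of_condIndep {Ω SD SW SV SH : Type*} [MeasurableSpace Ω]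
    [Fintype SD] [MeasurableSpace SD] [MeasurableSingletonClass SD]
    [Fintype SW] [MeasurableSpace SW] [MeasurableSingletonClass SW]
    [Fintype SV] [MeasurableSpace SV] [MeasurableSingletonClass SV]
    [Fintype SH] [MeasurableSpace SH] [MeasurableSingletonClass SH]
    (μ : Measure Ω) [IsProbabilityMeasure μ]
    (D : Ω → SD) (W : Ω → SW) (V : Ω → SV) (H : Ω → SH)
    (hD : Measurable D) (hW : Measurable W) (hV : Measurable V) (hH : Measurable H)
    (hMarkov : finCondMutualInfo μ W (fun ω => (D ω, H ω)) V = 0) :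
    finCondMutualInfo μ D W H ≤ finMutualInfo μ W V := by
  have hWH := finMutualInfo_nonneg μ hW hH
  have hWV := finCondMutualInfo_nonneg μ hW hV (hD.prodMk hH)
  have h₁ := finEntropy_equiv_comp μ (fun ω => (V ω, D ω, H ω)) (Equiv.prodComm _ _)
  have h₂ := finEntropy_equiv_comp μ (fun ω => (W ω, V ω, D ω, H ω))
    ((Equiv.refl SW).prodCongr (Equiv.prodComm SV (SD × SH)))
  have h₃ := finEntropy_equiv_comp μ (fun ω => (W ω, D ω, H ω))
    (((Equiv.prodAssoc SW SD SH).symm.trans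
      ((Equiv.prodComm SW SD).prodCongr (Equiv.refl SH))).trans (Equiv.prodAssoc SD SW SH))
  simp only [Equiv.prodComm_apply, Prod.swap_prod_mk, Equiv.prodCongr_apply, Prod.map_apply,
    Equiv.refl_apply, Equiv.trans_apply, Equiv.prodAssoc_apply, Equiv.prodAssoc_symm_apply]
    at h₁ h₂ h₃
  unfold finCondMutualInfo at hMarkov hWV ⊢
  unfold finMutualInfo at hWH ⊢
  linarith
end
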